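/- Let λ ∈ ℝⁿ be strictly decreasing (λ₁ > ⋯ > λₙ). For an n×n complex matrix H, let χ(H) denote the matrix with χ(H)_{ij} = H_{ij} for i > j, χ(H)_{ij} = −H_{ij} for i < j, and χ(H)_{ii} = 0 (so that for Hermitian H, χ(H) is the skew-Hermitian part of H in the Iwasawa decomposition). Let L : ℝ → (n×n complex matrices) be a differentiable function satisfying the full symmetric Toda equation L′(t) = [L(t), χ(−i·L(t))] for all t ∈ ℝ, with L(0) ∈ O_λ^{≥0}. Then L(t) ∈ O_λ^{≥0} for all t ∈ ℝ; that is, the full symmetric Toda flow weakly preserves positivity in both the positive and negative time directions. -/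

import Mathlib

open Matrix Finset

/-- The minor of a square matrix `g` on row set `I` and column set `J`
(rows and columns listed in increasing order); defined to be `0` if `I` and `J`
have different cardinalities. -/
noncomputable def minorOn {R : Type} [CommRing R] {n : ℕ} (g : Matrix (Fin n) (Fin n) R)
    (I J : Finset (Fin n)) : R :=
  if h : J.card = I.card then
    Matrix.det (Matrix.of fun a b : Fin I.card =>
      g ((I.orderIsoOfFin rfl a : Fin n)) ((J.orderIsoOfFin h b : Fin n)))
  else 0

/-- The left-justified minor `Δ_I(g)`: the minor on rows `I` and the first `|I|` columns. -/
noncomputable def leftMinor {R : Type} [CommRing R] {n : ℕ} (g : Matrix (Fin n) (Fin n) R)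
    (I : Finset (Fin n)) : R :=
  minorOn g I (Finset.univ.filter fun j : Fin n => (j : ℕ) < I.card)

/-- A complex number is a positive real. -/
def IsPosReal (z : ℂ) : Prop := 0 < z.re ∧ z.im = 0

/-- A complex number is a nonnegative real. -/
def IsNonnegReal (z : ℂ) : Prop := 0 ≤ z.re ∧ z.im = 0

/-- The diagonal sign matrix `δ_n = diag(1, −1, 1, …, (−1)^{n−1})`. -/
noncomputable def deltaMat (n : ℕ) : Matrix (Fin n) (Fin n) ℂ :=
  Matrix.diagonal fun i : Fin n => (-1 : ℂ) ^ (i : ℕ)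

/-- The totally positive part `U_n^{>0}` of the unitary group: unitary matrices all of
whose left-justified minors are positive real numbers. -/
def UnitaryTP (n : ℕ) : Set (Matrix (Fin n) (Fin n) ℂ) :=
  {g | g.conjTranspose * g = 1 ∧ ∀ I : Finset (Fin n), IsPosReal (leftMinor g I)}

/-- The totally positive part `O_λ^{>0}` of the adjoint orbit of `u_n`: skew-Hermitian
matrices `g · (i·diag(λ)) · g*` with `g ∈ U_n^{>0}`. -/
def SkewOrbitTP {n : ℕ} (lam : Fin n → ℝ) : Set (Matrix (Fin n) (Fin n) ℂ) :=
  {L | ∃ g ∈ UnitaryTP n,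
    L = g * (Complex.I • Matrix.diagonal (fun i => (lam i : ℂ))) * g.conjTranspose}

/-- The totally nonnegative part `O_λ^{≥0}`: the closure of `O_λ^{>0}` in the space of
`n×n` complex matrices. -/
noncomputable def SkewOrbitTNN {n : ℕ} (lam : Fin n → ℝ) : Set (Matrix (Fin n) (Fin n) ℂ) :=
  closure (SkewOrbitTP lam)

/-- `χ(H)` agrees with `H` strictly below the diagonal, with `−H` strictly above the
diagonal, and vanishes on the diagonal (for Hermitian `H` this is the skew-Hermitian
part of `H` in the Iwasawa decomposition). -/
def iwasawaSkewPart {n : ℕ} (H : Matrix (Fin n) (Fin n) ℂ) : Matrix (Fin n) (Fin n) ℂ :=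
  Matrix.of fun i j => if j < i then H i j else if i < j then -H i j else 0

section TPTheory
open scoped ComplexOrder

/-- Three-term Plücker relation. -/
theorem plucker3 {m : ℕ} (Y : Matrix (Fin (m+2)) (Fin (m+3)) ℂ) (q : Fin (m+1)) :
    (Y.submatrix id (q.castSucc.succ.succAbove)).det *
      (Y.submatrix Fin.succ (fun i : Fin (m+1) => i.castSucc.succ)).det
    = (Y.submatrix id Fin.succ).det *
        (Y.submatrix Fin.succ (fun i : Fin (m+1) => (q.succ.succAbove i).castSucc)).det
    + (Y.submatrix id Fin.castSucc).det *
        (Y.submatrix Fin.succ (fun i : Fin (m+1) => (q.castSucc.succAbove i).succ)).det := by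
  have h1 : ∀ a : Fin (m+2),
      ∑ i : Fin (m+3), (-1 : ℂ) ^ (i : ℕ) * Y a i * (Y.submatrix id i.succAbove).det = 0 := by
    intro a
    have h := Matrix.det_succ_row_zero
      (Matrix.of (Fin.cons (Y a) Y : Fin (m+3) → Fin (m+3) → ℂ))
    rw [Matrix.det_zero_of_row_eq (i := 0) (j := a.succ) (Fin.succ_ne_zero a).symm
      (by ext j; rfl)] at h
    rw [h]
    rfl
  set e : Fin m → Fin (m+3) := fun i => (q.succAbove i).castSucc.succ with he
  set ψ : Fin (m+3) → ℂ := fun i => ∑ a : Fin (m+1), (-1 : ℂ) ^ (a : ℕ) * Y a.succ i *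
    (Y.submatrix (fun b => (a.succAbove b).succ) e).det with hψ
  have h2 : ∀ (γ : Fin (m+1) → Fin (m+3)) (p : Fin (m+1)), (∀ i, γ (p.succAbove i) = e i) →
      (Y.submatrix Fin.succ γ).det = (-1 : ℂ) ^ (p : ℕ) * ψ (γ p) := by
    intro γ p hγ
    rw [Matrix.det_succ_column _ p, hψ, Finset.mul_sum]
    refine Finset.sum_congr rfl fun a _ => ?_
    have : (Y.submatrix Fin.succ γ).submatrix a.succAbove p.succAbove
        = Y.submatrix (fun b => (a.succAbove b).succ) e := by
      ext x y; simp [hγ]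
    rw [this]
    simp only [Matrix.submatrix_apply, pow_add]
    ring
  have h3 : ∀ b, ψ (e b) = 0 := by
    intro b
    have h := h2 (Fin.cons (e b) e) 0 (by intro i; simp)
    rw [Matrix.det_zero_of_column_eq (i := 0) (j := b.succ) (Fin.succ_ne_zero b).symm
      (by intro j; simp)] at h
    simpa using h.symm
  have h4 : ∑ i : Fin (m+3), (-1 : ℂ) ^ (i : ℕ) * (Y.submatrix id i.succAbove).det * ψ i = 0 := by
    simp only [hψ, Finset.mul_sum]
    rw [Finset.sum_comm]
    refine Finset.sum_eq_zero fun a _ => ?_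
    have := congrArg (fun z => z * ((-1 : ℂ) ^ (a : ℕ) *
      (Y.submatrix (fun b => (a.succAbove b).succ) e).det)) (h1 a.succ)
    simp only [zero_mul, Finset.sum_mul] at this
    rw [← this]
    refine Finset.sum_congr rfl fun i _ => by ring
  rw [Fin.sum_univ_succ, Fin.sum_univ_castSucc, Fin.sum_univ_succAbove _ q] at h4
  have h5 : ∀ b, ψ ((q.succAbove b).castSucc.succ) = 0 := h3
  simp only [h5, mul_zero, Finset.sum_const_zero, add_zero] at h4
  have g1 := h2 (fun i : Fin (m+1) => i.castSucc.succ) q (by intro i; rfl)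
  have g2 := h2 (fun i : Fin (m+1) => (q.succ.succAbove i).castSucc) 0 (by
    intro i; simp [he])
  have g3 := h2 (fun i : Fin (m+1) => (q.castSucc.succAbove i).succ) (Fin.last m) (by
    intro i; simp [he])
  rw [g1, g2, g3]
  have k1 : (q.succ.succAbove 0).castSucc = (0 : Fin (m+3)) := by simp
  have k2 : (q.castSucc.succAbove (Fin.last m)).succ = Fin.last (m+2) := by
    simp
  have k3 : (Fin.last (m+1)).succ = Fin.last (m+2) := rfl
  rw [k1, k2]
  rw [k3, Fin.succAbove_last, Fin.succAbove_zero] at h4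
  simp only [Fin.val_zero, Fin.val_succ, Fin.val_castSucc, Fin.val_last, pow_add, pow_zero,
    pow_one] at h4 ⊢
  linear_combination -h4

/-- Submatrix zero pattern. -/
theorem det_lower_zero {n k : ℕ} (X : Matrix (Fin n) (Fin n) ℂ) (hX : ∀ i j, i < j → X i j = 0)
    (r c : Fin k → Fin n) (hr : StrictMono r) (hc : StrictMono c) (a : Fin k) (ha : r a < c a) :
    (X.submatrix r c).det = 0 := by
  rw [Matrix.det_apply]
  refine Finset.sum_eq_zero fun σ _ => ?_
  -- some column `i ≥ a` with `σ i ≤ a`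
  obtain ⟨i, hi, hs⟩ : ∃ i, a ≤ i ∧ σ i ≤ a := by
    by_contra hcon
    push Not at hcon
    have hsub : (Finset.Ici a).image σ ⊆ Finset.Ioi a := by
      intro x hx
      obtain ⟨i, hi, rfl⟩ := Finset.mem_image.1 hx
      exact Finset.mem_Ioi.2 (hcon i (Finset.mem_Ici.1 hi))
    have := Finset.card_le_card hsub
    rw [Finset.card_image_of_injective _ σ.injective, Fin.card_Ici, Fin.card_Ioi] at this
    have := a.2
    omega
  have : ∏ i, X.submatrix r c (σ i) i = 0 := by
    refine Finset.prod_eq_zero (Finset.mem_univ i) ?_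
    exact hX _ _ (lt_of_le_of_lt (hr.monotone hs) (lt_of_lt_of_le ha (hc.monotone hi)))
  rw [this, smul_zero]

/-- all left-justified minors positive -/
def LeftPos {n : ℕ} (g : Matrix (Fin n) (Fin n) ℂ) : Prop :=
  ∀ (k : ℕ) (hk : k ≤ n) (r : Fin k → Fin n), StrictMono r →
    0 < (g.submatrix r (Fin.castLE hk)).det

/-- all bottom-justified minors positive -/
def BotPos {n : ℕ} (g : Matrix (Fin n) (Fin n) ℂ) : Prop :=
  ∀ (k : ℕ) (hk : k ≤ n) (c : Fin k → Fin n), StrictMono c →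
    0 < (g.submatrix (fun i : Fin k => (⟨n - k + i, by omega⟩ : Fin n)) c).det

theorem cpos_of_mul {a b : ℂ} (hb : 0 < b) (h : 0 < a * b) : 0 < a := by
  have h2 := mul_pos h (inv_pos.2 hb)
  rwa [mul_assoc, mul_inv_cancel₀ hb.ne', mul_one] at h2

/-- solid case -/
theorem det_lower_solid {n k : ℕ} (X : Matrix (Fin n) (Fin n) ℂ)
    (hX : ∀ i j, i < j → X i j = 0) (hL : LeftPos X) (r c : Fin k → Fin n) (hr : StrictMono r)
    (a : ℕ) (ha : ∀ i, (c i : ℕ) = a + i) (hak : a + k ≤ n) (hle : ∀ i, c i ≤ r i) :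
    0 < (X.submatrix r c).det := by
  have han : a ≤ n := by omega
  have h1 := hL a han (Fin.castLE han) (Fin.strictMono_castLE han)
  have hmono : StrictMono (Fin.append (Fin.castLE han) r) := by
    intro x y hxy
    induction x using Fin.addCases with
    | left x =>
      induction y using Fin.addCases with
      | left y => 
        simp only [Fin.append_left]
        exact hxy
      | right y => 
        simp only [Fin.append_left, Fin.append_right]
        refine lt_of_lt_of_le ?_ (hle y)
        rw [Fin.lt_def, ha]
        simp only [Fin.val_castLE]; omega
    | right x =>
      induction y using Fin.addCases with
      | left y => 
        exfalso
        rw [Fin.lt_def] at hxy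
        simp only [Fin.val_natAdd, Fin.val_castAdd] at hxy; omega
      | right y => 
        simp only [Fin.append_right]
        apply hr
        simpa using hxy
  have h2 := hL (a + k) hak _ hmono
  have h3 : X.submatrix (Fin.append (Fin.castLE han) r) (Fin.castLE hak) =
      (Matrix.fromBlocks (X.submatrix (Fin.castLE han) (Fin.castLE han)) 0
        (X.submatrix r (Fin.castLE han)) (X.submatrix r c)).submatrix
          finSumFinEquiv.symm finSumFinEquiv.symm := by
    have hcc : ∀ y : Fin k, Fin.castLE hak (Fin.natAdd a y) = c y := by
      intro y; apply Fin.ext; simp [ha]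
    ext x y
    induction x using Fin.addCases with
    | left x =>
      induction y using Fin.addCases with
      | left y => 
        simp
        rfl
      | right y => 
        simp
        apply hX
        rw [hcc, Fin.lt_def, ha]
        simp only [Fin.val_castLE]; omega
    | right x =>
      induction y using Fin.addCases with
      | left y => 
        simp
        rfl
      | right y => 
        simp [hcc]
  rw [h3, Matrix.det_submatrix_equiv_self, Matrix.det_fromBlocks_zero₁₂, mul_comm] at h2
  exact cpos_of_mul h1 h2

theorem key_pos {n : ℕ} (X : Matrix (Fin n) (Fin n) ℂ)
    (hX : ∀ i j, i < j → X i j = 0) (hL : LeftPos X) (k : ℕ) :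
    ∀ (r c : Fin k → Fin n), StrictMono r → StrictMono c → (∀ i, c i ≤ r i) →
    0 < (X.submatrix r c).det := by
  induction k with
  | zero => intro r c _ _ _; simp
  | succ k ihk =>
    have nn : ∀ (l : ℕ), (∀ (r c : Fin l → Fin n), StrictMono r → StrictMono c →
        (∀ i, c i ≤ r i) → 0 < (X.submatrix r c).det) → 
        ∀ (r c : Fin l → Fin n), StrictMono r → StrictMono c → 0 ≤ (X.submatrix r c).det := by
      intro l h r c hr hc
      by_cases hle : ∀ i, c i ≤ r i
      · exact (h r c hr hc hle).le
      · push Not at hle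
        obtain ⟨a, ha⟩ := hle
        rw [det_lower_zero X hX r c hr hc a ha]
    suffices H : ∀ d : ℕ, ∀ (r c : Fin (k+1) → Fin n), StrictMono r → StrictMono c →
        (c (Fin.last k) : ℕ) - c 0 = d → (∀ i, c i ≤ r i) → 0 < (X.submatrix r c).det by
      intro r c hr hc hle
      exact H _ r c hr hc rfl hle
    intro d
    induction d using Nat.strong_induction_on with
    | _ d ihd =>
    intro r c hr hc hd hle
    by_cases hsol : ∀ i : Fin k, (c i.succ : ℕ) = c i.castSucc + 1
    · have ha : ∀ i, (c i : ℕ) = c 0 + i := by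
        intro i
        induction i using Fin.induction with
        | zero => simp
        | succ i ih => rw [hsol, ih]; simp; omega
      refine det_lower_solid X hX hL r c hr (c 0) ha ?_ hle
      have := ha (Fin.last k)
      have := (c (Fin.last k)).2
      simp at *
      omega
    · push Not at hsol
      obtain ⟨i, hi⟩ := hsol
      have hlt : (c i.castSucc : ℕ) + 1 < c i.succ := by
        have : (c i.castSucc : ℕ) < c i.succ := hc (Fin.castSucc_lt_succ)
        omega
      obtain ⟨m, rfl⟩ : ∃ m, k = m + 1 := ⟨k - 1, by have := i.2; omega⟩
      set p : Fin n := ⟨c i.castSucc + 1, by have := (c i.succ).2; omega⟩ with hp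
      set f : Fin (m+3) → Fin n := Fin.insertNth i.castSucc.succ (α := fun _ ↦ Fin n) p c with hf
      have hfm : StrictMono f := by
        rw [hf]
        apply Fin.strictMono_insertNth hc
        · rw [Fin.lt_def]; simp [hp]
        · rw [Fin.lt_def]; simpa [hp] using hlt
      have hfc : ∀ j, f (i.castSucc.succ.succAbove j) = c j := by
        intro j; simp [hf]
      have hP := plucker3 (X.submatrix r f) i
      simp only [Matrix.submatrix_submatrix] at hP
      have e1 : f ∘ i.castSucc.succ.succAbove = c := funext hfc
      have hle' : ∀ j : Fin (m+2), f j.castSucc ≤ c j := by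
        intro j; rw [← hfc j]
        refine hfm.monotone ?_
        unfold Fin.succAbove
        split_ifs
        · exact le_rfl
        · exact (Fin.castSucc_lt_succ).le
      have hc0 : c 0 = f 0 := by rw [← hfc 0]; simp
      have hcl : c (Fin.last _) = f (Fin.last _) := by
        rw [← hfc (Fin.last _)]; congr 1
        simp
      have hrs : StrictMono (r ∘ Fin.succ) := hr.comp Fin.strictMono_succ
      have t1 : 0 < (X.submatrix (r ∘ Fin.succ)
          (f ∘ fun i : Fin (m+1) => i.castSucc.succ)).det := by
        apply ihk _ _ hrs
        · exact hfm.comp (Fin.strictMono_succ.comp Fin.strictMono_castSucc)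
        · intro j
          exact (hle' j.succ).trans (hle _)
      have hd' : ∀ c' : Fin (m+2) → Fin n, StrictMono c' →
          (c' (Fin.last _) : ℕ) - c' 0 < d → (∀ i, c' i ≤ r i) → 0 < (X.submatrix r c').det := 
        fun c' hc' hlt hle => ihd _ hlt r c' hr hc' rfl hle
      have hf0l : (f 0 : ℕ) < f (Fin.last _) := hfm (Fin.last_pos)
      have t2 : 0 < (X.submatrix (r ∘ id) (f ∘ Fin.castSucc)).det := by
        apply hd' _ (hfm.comp Fin.strictMono_castSucc)
        · rw [← hd, hc0, hcl]
          have : (f (Fin.last (m+1)).castSucc : ℕ) < f (Fin.last (m+2)) :=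
            hfm (Fin.castSucc_lt_last _)
          simp only [Function.comp, Fin.castSucc_zero]
          omega
        · intro j
          exact (hle' j).trans (hle _)
      have t3 : 0 < (X.submatrix (r ∘ Fin.succ)
          (f ∘ fun j : Fin (m+1) => (i.castSucc.succAbove j).succ)).det := by
        apply ihk _ _ hrs
        · exact hfm.comp (Fin.strictMono_succ.comp (Fin.strictMono_succAbove _))
        · intro j
          have : f (i.castSucc.succAbove j).succ = c j.succ := by
            rw [← hfc]; congr 1; simp
          simp only [Function.comp, this]
          exact hle _
      have t4 : 0 ≤ (X.submatrix (r ∘ Fin.succ)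
          (f ∘ fun j : Fin (m+1) => (i.succ.succAbove j).castSucc)).det := by
        apply nn _ ihk _ _ hrs
        exact hfm.comp (Fin.strictMono_castSucc.comp (Fin.strictMono_succAbove _))
      have t5 : 0 ≤ (X.submatrix (r ∘ id) (f ∘ Fin.succ)).det := by
        by_cases hle2 : ∀ j, f (Fin.succ j) ≤ r j
        · apply le_of_lt
          apply hd' _ (hfm.comp Fin.strictMono_succ) _ hle2
          rw [← hd, hc0, hcl]
          have : (f 0 : ℕ) < f (Fin.succ 0) := hfm (Fin.succ_pos _)
          simp only [Function.comp]
          have h9 : (Fin.last (m+1)).succ = Fin.last (m+2) := rfl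
          rw [h9]
          omega
        · push Not at hle2
          obtain ⟨a, ha⟩ := hle2
          exact (det_lower_zero X hX r _ hr (hfm.comp Fin.strictMono_succ) a ha).ge
      rw [e1] at hP
      refine cpos_of_mul t1 ?_
      change 0 < (X.submatrix (r ∘ id) c).det * _
      rw [hP]
      exact add_pos_of_nonneg_of_pos (mul_nonneg t5 t4) (mul_pos t2 t3)

theorem key_nonneg {n : ℕ} (X : Matrix (Fin n) (Fin n) ℂ)
    (hX : ∀ i j, i < j → X i j = 0) (hL : LeftPos X) (k : ℕ)
    (r c : Fin k → Fin n) (hr : StrictMono r) (hc : StrictMono c) :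
    0 ≤ (X.submatrix r c).det := by
  by_cases hle : ∀ i, c i ≤ r i
  · exact (key_pos X hX hL k r c hr hc hle).le
  · push Not at hle
    obtain ⟨a, ha⟩ := hle
    rw [det_lower_zero X hX r c hr hc a ha]

/-- A form of the Cauchy-Binet formula. -/
theorem cauchyBinet_fact {n k : ℕ} (A : Matrix (Fin k) (Fin n) ℂ) (B : Matrix (Fin n) (Fin k) ℂ) :
    (Fintype.card (Equiv.Perm (Fin k)) : ℂ) * (A * B).det =
      ∑ f : Fin k → Fin n, (A.submatrix id f).det * (B.submatrix f id).det := by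
  have h1 : (A * B).det = ∑ f : Fin k → Fin n, (∏ i, B (f i) i) * (A.submatrix id f).det := by
    simp only [Matrix.det_apply', Matrix.mul_apply, Finset.prod_univ_sum, Finset.mul_sum,
      Fintype.piFinset_univ]
    rw [Finset.sum_comm]
    refine Finset.sum_congr rfl fun f _ => Finset.sum_congr rfl fun σ _ => ?_
    simp only [Finset.prod_mul_distrib, Matrix.submatrix_apply, id]
    ring
  have h2 : ∀ σ : Equiv.Perm (Fin k), (A * B).det =
      ∑ f : Fin k → Fin n, (A.submatrix id f).det *
        ((Equiv.Perm.sign σ : ℂ) * ∏ i, B (f (σ i)) i) := by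
    intro σ
    rw [h1]
    refine (Fintype.sum_equiv (Equiv.arrowCongr σ.symm (Equiv.refl _)) _ _ fun f => ?_).symm
    have e : (Equiv.arrowCongr σ.symm (Equiv.refl (Fin n))) f = f ∘ σ := by
      ext x; simp
    rw [e]
    have := Matrix.det_permute' σ (A.submatrix id f)
    rw [Matrix.submatrix_submatrix] at this
    simp only [Function.comp_id] at this
    rw [this]
    simp only [Function.comp]
    ring
  have h3 : ∑ _σ : Equiv.Perm (Fin k), (A * B).det =
      ∑ f : Fin k → Fin n, (A.submatrix id f).det * (B.submatrix f id).det := by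
    rw [Finset.sum_congr rfl fun σ _ => h2 σ, Finset.sum_comm]
    refine Finset.sum_congr rfl fun f _ => ?_
    rw [← Finset.mul_sum, Matrix.det_apply' (B.submatrix f id)]
    rfl
  rw [← h3]
  simp

theorem cauchyBinet_pos {n k : ℕ} (A : Matrix (Fin k) (Fin n) ℂ) (B : Matrix (Fin n) (Fin k) ℂ)
    (hnn : ∀ s : Fin k → Fin n, StrictMono s →
      0 ≤ (A.submatrix id s).det * (B.submatrix s id).det)
    (hp : ∃ s : Fin k → Fin n, StrictMono s ∧
      0 < (A.submatrix id s).det * (B.submatrix s id).det) : 0 < (A * B).det := by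
  have h := cauchyBinet_fact A B
  have hnn' : ∀ f : Fin k → Fin n, 0 ≤ (A.submatrix id f).det * (B.submatrix f id).det := by
    intro f
    by_cases hf : Function.Injective f
    · have hs := hnn (f ∘ Tuple.sort f)
        ((Tuple.monotone_sort f).strictMono_of_injective (hf.comp (Tuple.sort f).injective))
      have a1 := Matrix.det_permute' (Tuple.sort f) (A.submatrix id f)
      have a2 := Matrix.det_permute (Tuple.sort f) (B.submatrix f id)
      rw [Matrix.submatrix_submatrix, Function.comp_id] at a1 a2
      rw [a1, a2] at hs
      have hsq : ((Equiv.Perm.sign (Tuple.sort f) : ℤ) : ℂ) *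
          ((Equiv.Perm.sign (Tuple.sort f) : ℤ) : ℂ) = 1 := by
        rw [← Int.cast_mul, ← Units.val_mul, Int.units_mul_self]; simp
      calc (0 : ℂ) ≤ _ := hs
        _ = (((Equiv.Perm.sign (Tuple.sort f) : ℤ) : ℂ) *
          ((Equiv.Perm.sign (Tuple.sort f) : ℤ) : ℂ)) *
            ((A.submatrix id f).det * (B.submatrix f id).det) := by ring
        _ = _ := by rw [hsq, one_mul]
    · simp only [Function.Injective] at hf
      push Not at hf
      obtain ⟨a, b, hab, hne⟩ := hf
      rw [Matrix.det_zero_of_column_eq (i := a) (j := b) hne (by intro x; simp [hab]), zero_mul]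
  have hpos : 0 < ∑ f : Fin k → Fin n, (A.submatrix id f).det * (B.submatrix f id).det := by
    obtain ⟨s, _, hs⟩ := hp
    exact Finset.sum_pos' (fun f _ => hnn' f) ⟨s, Finset.mem_univ _, hs⟩
  rw [← h, mul_comm] at hpos
  refine cpos_of_mul ?_ hpos
  exact_mod_cast Fintype.card_pos

/-- Restricting a product to an index block. -/
theorem submatrix_mul_block {n k : ℕ} {α β : Type} (A B : Matrix (Fin n) (Fin n) ℂ)
    (r : α → Fin n) (c : β → Fin n) (e : Fin k → Fin n) (he : Function.Injective e)
    (h : ∀ a b l, l ∉ Set.range e → A (r a) l * B l (c b) = 0) :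
    (A * B).submatrix r c = A.submatrix r e * B.submatrix e c := by
  ext a b
  simp only [Matrix.submatrix_apply, Matrix.mul_apply]
  exact (Fintype.sum_of_injective e he _ _ (fun l hl => h a b l hl) (fun _ => rfl)).symm

theorem upper_sub_det_pos {n k : ℕ} (B : Matrix (Fin n) (Fin n) ℂ)
    (hB : ∀ l j, j < l → B l j = 0) (hd : ∀ j, 0 < B j j)
    (e : Fin k → Fin n) (he : StrictMono e) : 0 < (B.submatrix e e).det := by
  rw [Matrix.det_of_isUpperTriangular]
  · exact Finset.prod_pos fun i _ => hd _
  · intro i j hij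
    exact hB _ _ (he hij)

theorem not_range_castLE {n k : ℕ} (hk : k ≤ n) (l : Fin n)
    (hl : l ∉ Set.range (Fin.castLE hk)) : k ≤ l := by
  by_contra h
  push Not at h
  exact hl ⟨⟨l, h⟩, rfl⟩

/-- bottom rows -/
def botE {n k : ℕ} (hk : k ≤ n) (i : Fin k) : Fin n := ⟨n - k + i, by omega⟩

theorem botE_strictMono {n k : ℕ} (hk : k ≤ n) : StrictMono (botE hk) := by
  intro a b hab
  rw [Fin.lt_def] at hab ⊢
  simp only [botE]; omega

theorem not_range_botE {n k : ℕ} (hk : k ≤ n) (l : Fin n)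
    (hl : l ∉ Set.range (botE hk)) : (l : ℕ) < n - k := by
  by_contra h
  push Not at h
  refine hl ⟨⟨l - (n - k), by have := l.2; omega⟩, Fin.ext ?_⟩
  simp only [botE]; omega

theorem left_mul_upper {n k : ℕ} (hk : k ≤ n) (g B : Matrix (Fin n) (Fin n) ℂ)
    (hB : ∀ l j, j < l → B l j = 0) (r : Fin k → Fin n) :
    ((g * B).submatrix r (Fin.castLE hk)).det =
      (g.submatrix r (Fin.castLE hk)).det * (B.submatrix (Fin.castLE hk) (Fin.castLE hk)).det := by
  rw [submatrix_mul_block g B r _ (Fin.castLE hk) (Fin.strictMono_castLE hk).injective,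
    Matrix.det_mul]
  intro a b l hl
  have := not_range_castLE hk l hl
  rw [hB l, mul_zero]
  rw [Fin.lt_def]; simp only [Fin.val_castLE]; omega

theorem bot_upper_mul {n k : ℕ} (hk : k ≤ n) (U g : Matrix (Fin n) (Fin n) ℂ)
    (hU : ∀ l j, j < l → U l j = 0) (c : Fin k → Fin n) :
    ((U * g).submatrix (botE hk) c).det =
      (U.submatrix (botE hk) (botE hk)).det * (g.submatrix (botE hk) c).det := by
  rw [submatrix_mul_block U g _ c (botE hk) (botE_strictMono hk).injective,
    Matrix.det_mul]
  intro a b l hl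
  have := not_range_botE hk l hl
  rw [hU _ l, zero_mul]
  rw [Fin.lt_def]; simp only [botE]; omega

theorem exists_upper {n : ℕ} (g : Matrix (Fin n) (Fin n) ℂ) (hg : LeftPos g) :
    ∃ B : Matrix (Fin n) (Fin n) ℂ, (∀ l j, j < l → B l j = 0) ∧ (∀ j, 0 < B j j) ∧
      (∀ i j, i < j → (g * B) i j = 0) ∧ (∀ j, 0 < (g * B) j j) := by
  let A : (j : Fin n) → Matrix (Fin (j+1)) (Fin (j+1)) ℂ := fun j =>
    g.submatrix (Fin.castLE (Nat.succ_le_of_lt j.2)) (Fin.castLE (Nat.succ_le_of_lt j.2))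
  let B : Matrix (Fin n) (Fin n) ℂ := fun l j =>
    if h : (l : ℕ) < j + 1 then (A j).adjugate ⟨l, h⟩ (Fin.last _) else 0
  have hN : ∀ (j : Fin n) (i : Fin (j+1)),
      (g * B) (Fin.castLE (Nat.succ_le_of_lt j.2) i) j =
        (A j).det * (1 : Matrix (Fin (j+1)) (Fin (j+1)) ℂ) i (Fin.last _) := by
    intro j i
    have := congrFun (congrFun (Matrix.mul_adjugate (A j)) i) (Fin.last _)
    rw [Matrix.smul_apply, smul_eq_mul] at this
    rw [← this, Matrix.mul_apply, Matrix.mul_apply]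
    refine (Fintype.sum_of_injective (Fin.castLE (Nat.succ_le_of_lt j.2))
      (Fin.strictMono_castLE _).injective _ _ ?_ ?_).symm
    · intro l hl
      have := not_range_castLE _ l hl
      have hB : B l j = 0 := dif_neg (by simp at this; omega)
      rw [hB, mul_zero]
    · intro l
      have hB : B (Fin.castLE (Nat.succ_le_of_lt j.2) l) j = (A j).adjugate l (Fin.last _) :=
        dif_pos l.2
      rw [hB]; rfl
  refine ⟨B, ?_, ?_, ?_, ?_⟩
  · intro l j hlj
    exact dif_neg (by rw [Fin.lt_def] at hlj; omega)
  · intro j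
    have hB : B j j = (A j).adjugate (Fin.last _) (Fin.last _) := dif_pos (Nat.lt_succ_self _)
    rw [hB, Matrix.adjugate_fin_succ_eq_det_submatrix]
    have h1 := hg j j.2.le _ (Fin.strictMono_castLE j.2.le)
    have h2 : (A j).submatrix (Fin.last (j : ℕ)).succAbove (Fin.last (j : ℕ)).succAbove =
      g.submatrix (Fin.castLE j.2.le) (Fin.castLE j.2.le) := by
      ext a b; simp [A]
    rw [h2]
    rw [← two_mul, pow_mul]
    simpa using h1
  · intro i j hij
    have := hN j ⟨i, by rw [Fin.lt_def] at hij; omega⟩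
    rw [Matrix.one_apply_ne, mul_zero] at this
    · exact this
    · intro h
      have := congrArg Fin.val h
      simp at this
      rw [Fin.lt_def] at hij; omega
  · intro j
    have := hN j (Fin.last _)
    rw [Matrix.one_apply_eq, mul_one] at this
    have h2 : Fin.castLE (Nat.succ_le_of_lt j.2) (Fin.last (j:ℕ)) = j := rfl
    rw [h2] at this
    rw [this]
    exact hg _ _ _ (Fin.strictMono_castLE _)

theorem botPos_of_leftPos {n : ℕ} (g : Matrix (Fin n) (Fin n) ℂ) (hu : gᴴ * g = 1)
    (hg : LeftPos g) : BotPos g := by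
  obtain ⟨B, hBu, hBd, hNl, hNd⟩ := exists_upper g hg
  set N := g * B with hN
  have hCN : Nᴴ * g = Bᴴ := by
    rw [hN, Matrix.conjTranspose_mul, Matrix.mul_assoc, hu, Matrix.mul_one]
  have hNN : Bᴴ * B = Nᴴ * N := by
    rw [← hCN, Matrix.mul_assoc]
  have hNL : LeftPos N := by
    intro k hk r hr
    rw [hN, left_mul_upper hk g B hBu]
    exact mul_pos (hg k hk r hr) (upper_sub_det_pos B hBu hBd _ (Fin.strictMono_castLE hk))
  have hCl : ∀ i j, i < j → Bᴴ i j = 0 := by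
    intro i j hij
    rw [Matrix.conjTranspose_apply, hBu _ _ hij, star_zero]
  have hCL : LeftPos Bᴴ := by
    intro k hk r hr
    have h1 : 0 < ((Bᴴ * B).submatrix r (Fin.castLE hk)).det := by
      rw [hNN]
      have e : (Nᴴ * N).submatrix r (Fin.castLE hk) =
        Nᴴ.submatrix r id * N.submatrix id (Fin.castLE hk) := by
        ext a b; simp [Matrix.mul_apply]
      rw [e]
      have e2 : ∀ s : Fin k → Fin n, ((Nᴴ.submatrix r id).submatrix id s).det =
          star ((N.submatrix s r).det) := by
        intro s
        rw [← Matrix.det_conjTranspose]; rfl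
      apply cauchyBinet_pos
      · intro s hs
        rw [e2]
        exact mul_nonneg (star_nonneg_iff.2 (key_nonneg N hNl hNL k s r hs hr))
          (hNL k hk s hs).le
      · refine ⟨r, hr, ?_⟩
        rw [e2]
        exact mul_pos (star_pos_iff.2 (key_pos N hNl hNL k r r hr hr fun _ => le_rfl))
          (hNL k hk r hr)
    rw [left_mul_upper hk _ B hBu] at h1
    exact cpos_of_mul (upper_sub_det_pos B hBu hBd _ (Fin.strictMono_castLE hk)) h1
  intro k hk c hc
  have h1 : 0 < (Bᴴ.submatrix (botE hk) c).det := by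
    refine key_pos _ hCl hCL k _ c (botE_strictMono hk) hc ?_
    intro i
    -- `c i ≤ n - k + i`
    have : ∀ (m : ℕ) (i : Fin k), (i : ℕ) + m + 1 = k → (c i : ℕ) + m + 1 ≤ n := by
      intro m
      induction m with
      | zero => intro i _; have := (c i).2; omega
      | succ m ih =>
        intro i hi
        have h2 := ih ⟨i + 1, by omega⟩ (by simp; omega)
        have h3 : (c i : ℕ) < c ⟨i + 1, by omega⟩ := hc (by rw [Fin.lt_def]; simp)
        omega
    have h2 := this (k - 1 - i) i (by have := i.2; omega)
    rw [Fin.le_def]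
    simp only [botE]
    have := i.2
    omega
  have hU : ∀ l j, j < l → Nᴴ l j = 0 := by
    intro l j h
    rw [Matrix.conjTranspose_apply, hNl _ _ h, star_zero]
  rw [← hCN, bot_upper_mul hk _ g hU, mul_comm] at h1
  refine cpos_of_mul (upper_sub_det_pos _ hU ?_ _ (botE_strictMono hk)) h1
  intro j
  rw [Matrix.conjTranspose_apply]
  exact star_pos_iff.2 (hNd j)

/-- antitranspose -/
def antiT {n : ℕ} (g : Matrix (Fin n) (Fin n) ℂ) : Matrix (Fin n) (Fin n) ℂ :=
  (g.submatrix Fin.rev Fin.rev)ᵀ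

theorem antiT_antiT {n : ℕ} (g : Matrix (Fin n) (Fin n) ℂ) : antiT (antiT g) = g := by
  ext i j; simp [antiT]

theorem antiT_det {n k : ℕ} (g : Matrix (Fin n) (Fin n) ℂ) (r c : Fin k → Fin n) :
    ((antiT g).submatrix r c).det =
      (g.submatrix (Fin.rev ∘ c ∘ Fin.rev) (Fin.rev ∘ r ∘ Fin.rev)).det := by
  have : (antiT g).submatrix r c = ((g.submatrix (Fin.rev ∘ c ∘ Fin.rev)
      (Fin.rev ∘ r ∘ Fin.rev)).submatrix Fin.revPerm Fin.revPerm)ᵀ := by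
    ext i j; simp [antiT]
  rw [this, Matrix.det_transpose, Matrix.det_submatrix_equiv_self]

theorem rev_comp_strictMono {n k : ℕ} (r : Fin k → Fin n) (hr : StrictMono r) :
    StrictMono (Fin.rev ∘ r ∘ Fin.rev) := by
  intro a b hab
  exact Fin.rev_lt_rev.2 (hr (Fin.rev_lt_rev.2 hab))

theorem rev_castLE {n k : ℕ} (hk : k ≤ n) :
    Fin.rev ∘ Fin.castLE hk ∘ Fin.rev = botE hk := by
  ext i; simp [botE, Fin.rev]; omega

theorem rev_botE {n k : ℕ} (hk : k ≤ n) :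
    Fin.rev ∘ botE hk ∘ Fin.rev = Fin.castLE hk := by
  ext i; simp [botE, Fin.rev]; omega

theorem leftPos_of_botPos {n : ℕ} (g : Matrix (Fin n) (Fin n) ℂ) (hu : gᴴ * g = 1)
    (hg : BotPos g) : LeftPos g := by
  have h1 : LeftPos (antiT g) := by
    intro k hk r hr
    rw [antiT_det, rev_castLE]
    exact hg k hk _ (rev_comp_strictMono r hr)
  have hu' : (antiT g)ᴴ * antiT g = 1 := by
    have hu2 : g * gᴴ = 1 := mul_eq_one_comm.1 hu
    have e : (antiT g)ᴴ * antiT g = ((g * gᴴ).submatrix Fin.rev Fin.rev)ᵀ := by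
      ext i j
      simp only [antiT, Matrix.mul_apply, Matrix.conjTranspose_apply, Matrix.transpose_apply,
        Matrix.submatrix_apply]
      refine Fintype.sum_equiv Fin.revPerm _ _ fun x => ?_
      simp [mul_comm]
    rw [e, hu2]
    ext i j
    simp [Matrix.one_apply, eq_comm]
  have h2 := botPos_of_leftPos _ hu' h1
  intro k hk r hr
  have h3 := h2 k hk _ (rev_comp_strictMono r hr)
  change 0 < ((antiT g).submatrix (botE hk) _).det at h3
  rw [antiT_det, rev_botE] at h3
  convert h3 using 3
  ext i; simp

theorem leftPos_iff {n : ℕ} (g : Matrix (Fin n) (Fin n) ℂ) :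
    LeftPos g ↔ ∀ I : Finset (Fin n), IsPosReal (leftMinor g I) := by
  have hpr : ∀ z : ℂ, IsPosReal z ↔ 0 < z := by
    intro z
    rw [Complex.lt_def, IsPosReal]
    simp [eq_comm]
  have key : ∀ I : Finset (Fin n), ∃ hk : I.card ≤ n, leftMinor g I =
      (g.submatrix (I.orderEmbOfFin rfl) (Fin.castLE hk)).det := by
    intro I
    have hk : I.card ≤ n := by simpa using I.card_le_univ
    refine ⟨hk, ?_⟩
    have hJ : (Finset.univ.filter fun j : Fin n => (j : ℕ) < I.card).card = I.card := by
      rw [Fin.card_filter_val_lt]; omega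
    unfold leftMinor minorOn
    rw [dif_pos hJ]
    congr 1
    have hu := Finset.orderEmbOfFin_unique hJ (f := Fin.castLE hk) (by intro x; simp)
      (Fin.strictMono_castLE hk)
    ext a b
    rw [Matrix.submatrix_apply, hu]
    rfl
  constructor
  · intro h I
    obtain ⟨hk, e⟩ := key I
    rw [hpr, e]
    exact h _ hk _ (I.orderEmbOfFin rfl).strictMono
  · intro h k hk r hr
    have hcard : (Finset.univ.image r).card = k := by
      rw [Finset.card_image_of_injective _ hr.injective]; simp
    generalize hI : Finset.univ.image r = I at hcard
    subst hcard
    obtain ⟨hk', e⟩ := key I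
    have h1 := h I
    rw [hpr, e] at h1
    have hu := Finset.orderEmbOfFin_unique (s := I) rfl (f := r)
      (by intro x; rw [← hI]; simp) hr
    rw [hu]
    exact h1

end TPTheory

section QR
open InnerProductSpace
open scoped ComplexOrder

/-- columns as Euclidean vectors -/
noncomputable def ecol {n : ℕ} (X : Matrix (Fin n) (Fin n) ℂ) (j : Fin n) :
    EuclideanSpace ℂ (Fin n) := WithLp.toLp 2 (fun i => X i j)

/-- the unitary factor in the QR decomposition -/
noncomputable def qrK {n : ℕ} (X : Matrix (Fin n) (Fin n) ℂ) : Matrix (Fin n) (Fin n) ℂ :=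
  Matrix.of fun i j => gramSchmidtNormed ℂ (ecol X) j i

theorem ecol_li {n : ℕ} (X : Matrix (Fin n) (Fin n) ℂ) (hX : IsUnit X) :
    LinearIndependent ℂ (ecol X) := by
  have h := Matrix.linearIndependent_cols_iff_isUnit.2 hX
  exact h.map' (WithLp.linearEquiv 2 ℂ (Fin n → ℂ)).symm.toLinearMap (LinearEquiv.ker _)

theorem conjTranspose_mul_inner {n : ℕ} (A B : Matrix (Fin n) (Fin n) ℂ) (i j : Fin n) :
    (Aᴴ * B) i j = inner ℂ (ecol A i) (ecol B j) := by
  rw [Matrix.mul_apply, PiLp.inner_apply]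
  refine Finset.sum_congr rfl fun x _ => ?_
  simp [ecol, mul_comm]

theorem ecol_qrK {n : ℕ} (X : Matrix (Fin n) (Fin n) ℂ) (j : Fin n) :
    ecol (qrK X) j = gramSchmidtNormed ℂ (ecol X) j := by
  ext i; rfl

theorem qrK_unitary {n : ℕ} (X : Matrix (Fin n) (Fin n) ℂ) (hX : IsUnit X) :
    (qrK X)ᴴ * qrK X = 1 := by
  have h := gramSchmidtNormed_orthonormal (ecol_li X hX)
  rw [orthonormal_iff_ite] at h
  ext i j
  rw [conjTranspose_mul_inner, ecol_qrK, ecol_qrK, h, Matrix.one_apply]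

theorem qrR_upper {n : ℕ} (X : Matrix (Fin n) (Fin n) ℂ) (i j : Fin n) (hij : j < i) :
    ((qrK X)ᴴ * X) i j = 0 := by
  rw [conjTranspose_mul_inner, ecol_qrK, gramSchmidtNormed, inner_smul_left,
    gramSchmidt_inv_triangular ℂ _ hij, mul_zero]

theorem qrR_diag {n : ℕ} (X : Matrix (Fin n) (Fin n) ℂ) (hX : IsUnit X) (i : Fin n) :
    0 < ((qrK X)ᴴ * X) i i := by
  rw [conjTranspose_mul_inner, ecol_qrK, gramSchmidtNormed, inner_smul_left]
  have h0 := gramSchmidt_ne_zero i (ecol_li X hX)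
  have h1 : inner ℂ (gramSchmidt ℂ (ecol X) i) (ecol X i)
      = (‖gramSchmidt ℂ (ecol X) i‖ : ℂ) ^ 2 := by
    conv_lhs => rw [gramSchmidt_def'' ℂ (ecol X) i]
    rw [inner_add_right, inner_sum, Finset.sum_eq_zero, add_zero]
    · exact inner_self_eq_norm_sq_to_K _
    · intro k hk
      rw [inner_smul_right, gramSchmidt_orthogonal ℂ (ecol X) (Finset.mem_Iio.1 hk).ne', mul_zero]
  rw [h1]
  have h2 : (0:ℝ) < ‖gramSchmidt ℂ (ecol X) i‖ := norm_pos_iff.2 h0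
  have h3 : (starRingEnd ℂ) ((‖gramSchmidt ℂ (ecol X) i‖ : ℂ)⁻¹) *
      (‖gramSchmidt ℂ (ecol X) i‖ : ℂ) ^ 2 = ((‖gramSchmidt ℂ (ecol X) i‖ : ℝ) : ℂ) := by
    rw [map_inv₀, Complex.conj_ofReal]
    have : ((‖gramSchmidt ℂ (ecol X) i‖ : ℝ) : ℂ) ≠ 0 := by exact_mod_cast h2.ne'
    field_simp
  refine lt_of_lt_of_eq ?_ h3.symm
  exact_mod_cast h2

theorem gs_formula {n : ℕ} (f : Fin n → EuclideanSpace ℂ (Fin n)) (j : Fin n) :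
    gramSchmidt ℂ f j = f j - ∑ i ∈ Finset.Iio j,
      (inner ℂ (gramSchmidt ℂ f i) (f j) / (‖gramSchmidt ℂ f i‖ : ℂ) ^ 2) •
        gramSchmidt ℂ f i :=
  eq_sub_of_add_eq (gramSchmidt_def'' ℂ f j).symm

theorem qrK_differentiable {n : ℕ} (X : ℝ → Matrix (Fin n) (Fin n) ℂ) (t : ℝ)
    (hX : IsUnit (X t)) (hd : ∀ i j, DifferentiableAt ℝ (fun s => X s i j) t) (i j : Fin n) :
    DifferentiableAt ℝ (fun s => qrK (X s) i j) t := by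
  have hc : ∀ j, DifferentiableAt ℝ (fun s => ecol (X s) j) t := by
    intro j
    exact ((PiLp.continuousLinearEquiv 2 ℝ (fun _ : Fin n => ℂ)).symm.differentiableAt).comp t
      (differentiableAt_pi.2 fun i => hd i j)
  have hg : ∀ j, DifferentiableAt ℝ (fun s => gramSchmidt ℂ (ecol (X s)) j) t := by
    intro j
    induction j using WellFoundedLT.induction with
    | _ j ih =>
    have e : (fun s => gramSchmidt ℂ (ecol (X s)) j) = fun s => ecol (X s) j -
      ∑ i ∈ Finset.Iio j,
      (inner ℂ (gramSchmidt ℂ (ecol (X s)) i) (ecol (X s) j) /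
        (‖gramSchmidt ℂ (ecol (X s)) i‖ : ℂ) ^ 2) • gramSchmidt ℂ (ecol (X s)) i :=
      funext fun s => gs_formula _ _
    rw [e]
    refine (hc j).sub (DifferentiableAt.fun_sum fun i hi => ?_)
    have hi' := ih i (Finset.mem_Iio.1 hi)
    have h0 := gramSchmidt_ne_zero i (ecol_li (X t) hX)
    refine DifferentiableAt.smul (DifferentiableAt.div (hi'.inner ℂ (hc j)) ?_ ?_) hi'
    · exact (Complex.ofRealCLM.differentiableAt.comp t (hi'.norm ℂ h0)).pow 2
    · simpa using h0
  have h0 := gramSchmidt_ne_zero j (ecol_li (X t) hX)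
  have hN : DifferentiableAt ℝ (fun s => gramSchmidtNormed ℂ (ecol (X s)) j) t := by
    have h1 : DifferentiableAt ℝ (fun s => ((‖gramSchmidt ℂ (ecol (X s)) j‖ : ℝ) : ℂ)) t :=
      Complex.ofRealCLM.differentiableAt.comp t ((hg j).norm ℂ h0)
    have h2 : DifferentiableAt ℝ (fun s => ((‖gramSchmidt ℂ (ecol (X s)) j‖ : ℝ) : ℂ)⁻¹) t :=
      h1.fun_inv (by simpa using h0)
    exact h2.fun_smul (hg j)
  have h3 := ((PiLp.continuousLinearEquiv 2 ℝ (fun _ : Fin n => ℂ)).differentiableAt).comp t hN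
  exact differentiableAt_pi.1 h3 i

theorem qrK_continuousAt {n : ℕ} {E : Type} [TopologicalSpace E]
    (X : E → Matrix (Fin n) (Fin n) ℂ) (t : E)
    (hX : IsUnit (X t)) (hd : ∀ i j, ContinuousAt (fun s => X s i j) t) (i j : Fin n) :
    ContinuousAt (fun s => qrK (X s) i j) t := by
  have hc : ∀ j, ContinuousAt (fun s => ecol (X s) j) t := by
    intro j
    unfold ecol
    exact (PiLp.continuous_toLp 2 _).continuousAt.comp
      (continuousAt_pi.2 fun i => hd i j)
  have hg : ∀ j, ContinuousAt (fun s => gramSchmidt ℂ (ecol (X s)) j) t := by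
    intro j
    induction j using WellFoundedLT.induction with
    | _ j ih =>
    have e : (fun s => gramSchmidt ℂ (ecol (X s)) j) = fun s => ecol (X s) j -
      ∑ i ∈ Finset.Iio j,
      (inner ℂ (gramSchmidt ℂ (ecol (X s)) i) (ecol (X s) j) /
        (‖gramSchmidt ℂ (ecol (X s)) i‖ : ℂ) ^ 2) • gramSchmidt ℂ (ecol (X s)) i :=
      funext fun s => gs_formula _ _
    rw [e]
    refine (hc j).sub (tendsto_finsetSum _ fun i hi => ?_)
    have hi' := ih i (Finset.mem_Iio.1 hi)
    have h0 := gramSchmidt_ne_zero i (ecol_li (X t) hX)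
    refine ContinuousAt.smul (ContinuousAt.div (ContinuousAt.inner (𝕜 := ℂ) hi' (hc j)) ?_ ?_) hi'
    · exact (Complex.continuous_ofReal.continuousAt.comp hi'.norm).pow 2
    · simpa using h0
  have h0 := gramSchmidt_ne_zero j (ecol_li (X t) hX)
  have hN : ContinuousAt (fun s => gramSchmidtNormed ℂ (ecol (X s)) j) t := by
    have h1 : ContinuousAt (fun s => ((‖gramSchmidt ℂ (ecol (X s)) j‖ : ℝ) : ℂ)) t :=
      Complex.continuous_ofReal.continuousAt.comp (hg j).norm
    have h2 : ContinuousAt (fun s => ((‖gramSchmidt ℂ (ecol (X s)) j‖ : ℝ) : ℂ)⁻¹) t :=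
      h1.inv₀ (by simpa using h0)
    exact ContinuousAt.smul h2 (hg j)
  exact (PiLp.continuous_apply 2 _ i).continuousAt.comp hN

theorem qrK_one {n : ℕ} : qrK (1 : Matrix (Fin n) (Fin n) ℂ) = 1 := by
  have ho : Pairwise fun a b => inner ℂ (ecol (1 : Matrix (Fin n) (Fin n) ℂ) a)
      (ecol (1 : Matrix (Fin n) (Fin n) ℂ) b) = 0 := by
    intro a b hab
    rw [← conjTranspose_mul_inner]
    simp [hab]
  have h1 := gramSchmidt_of_orthogonal ℂ ho
  have hn : ∀ j, ‖ecol (1 : Matrix (Fin n) (Fin n) ℂ) j‖ = 1 := by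
    intro j
    have h2 : inner ℂ (ecol (1 : Matrix (Fin n) (Fin n) ℂ) j) (ecol 1 j) = 1 := by
      rw [← conjTranspose_mul_inner]; simp
    rw [inner_self_eq_norm_sq_to_K] at h2
    have h3 : ‖ecol (1 : Matrix (Fin n) (Fin n) ℂ) j‖ ^ 2 = 1 := by
      have h2' : ((‖ecol (1 : Matrix (Fin n) (Fin n) ℂ) j‖ : ℝ) : ℂ) ^ 2 = 1 := h2
      exact_mod_cast h2'
    nlinarith [norm_nonneg (ecol (1 : Matrix (Fin n) (Fin n) ℂ) j)]
  ext i j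
  simp only [qrK, Matrix.of_apply, gramSchmidtNormed, h1, hn]
  simp [ecol]

end QR

section Toda
open scoped ComplexOrder

/-- entrywise derivative -/
def HasD {n : ℕ} (A : ℝ → Matrix (Fin n) (Fin n) ℂ) (A' : Matrix (Fin n) (Fin n) ℂ) (t : ℝ) :
    Prop := ∀ i j, HasDerivAt (fun s => A s i j) (A' i j) t

theorem HasD.mul {n : ℕ} {A B : ℝ → Matrix (Fin n) (Fin n) ℂ} {A' B' : Matrix (Fin n) (Fin n) ℂ}
    {t : ℝ} (hA : HasD A A' t) (hB : HasD B B' t) :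
    HasD (fun s => A s * B s) (A' * B t + A t * B') t := by
  intro i j
  simp only [Matrix.mul_apply, Matrix.add_apply, ← Finset.sum_add_distrib]
  exact HasDerivAt.fun_sum fun l _ => (hA i l).mul (hB l j)

theorem HasD.conjT {n : ℕ} {A : ℝ → Matrix (Fin n) (Fin n) ℂ} {A' : Matrix (Fin n) (Fin n) ℂ}
    {t : ℝ} (hA : HasD A A' t) : HasD (fun s => (A s)ᴴ) A'ᴴ t := by
  intro i j
  exact (hA j i).star

theorem HasD.const {n : ℕ} (A : Matrix (Fin n) (Fin n) ℂ) (t : ℝ) : HasD (fun _ => A) 0 t := by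
  intro i j
  exact hasDerivAt_const _ _

theorem HasD.unique {n : ℕ} {A : ℝ → Matrix (Fin n) (Fin n) ℂ} {A' B' : Matrix (Fin n) (Fin n) ℂ}
    {t : ℝ} (hA : HasD A A' t) (hB : HasD A B' t) : A' = B' := by
  ext i j
  exact (hA i j).unique (hB i j)

/-- `e^{tΛ}` -/
noncomputable def expD {n : ℕ} (lam : Fin n → ℝ) (t : ℝ) : Matrix (Fin n) (Fin n) ℂ :=
  Matrix.diagonal fun i => ((Real.exp (t * lam i) : ℝ) : ℂ)

noncomputable def todaX {n : ℕ} (lam : Fin n → ℝ) (t : ℝ) (g : Matrix (Fin n) (Fin n) ℂ) :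
    Matrix (Fin n) (Fin n) ℂ := g * expD lam t * gᴴ

noncomputable def todaH {n : ℕ} (lam : Fin n → ℝ) (t : ℝ) (g : Matrix (Fin n) (Fin n) ℂ) :
    Matrix (Fin n) (Fin n) ℂ := (qrK (todaX lam t g))ᴴ * g

theorem expD_mul_neg {n : ℕ} (lam : Fin n → ℝ) (t : ℝ) : expD lam t * expD lam (-t) = 1 := by
  unfold expD
  rw [Matrix.diagonal_mul_diagonal, ← Matrix.diagonal_one]
  congr 1
  ext i
  rw [← Complex.ofReal_mul, ← Real.exp_add]
  simp

theorem todaX_isUnit {n : ℕ} (lam : Fin n → ℝ) (t : ℝ) (g : Matrix (Fin n) (Fin n) ℂ)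
    (hu : gᴴ * g = 1) : IsUnit (todaX lam t g) := by
  have hu2 : g * gᴴ = 1 := mul_eq_one_comm.1 hu
  have h : todaX lam t g * (g * expD lam (-t) * gᴴ) = 1 := by
    unfold todaX
    calc g * expD lam t * gᴴ * (g * expD lam (-t) * gᴴ)
        = g * expD lam t * (gᴴ * g) * expD lam (-t) * gᴴ := by noncomm_ring
      _ = g * (expD lam t * expD lam (-t)) * gᴴ := by rw [hu]; noncomm_ring
      _ = 1 := by rw [expD_mul_neg, Matrix.mul_one, hu2]
  exact IsUnit.of_mul_eq_one _ h

theorem todaH_unitary {n : ℕ} (lam : Fin n → ℝ) (t : ℝ) (g : Matrix (Fin n) (Fin n) ℂ)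
    (hu : gᴴ * g = 1) : (todaH lam t g)ᴴ * todaH lam t g = 1 := by
  have hk := mul_eq_one_comm.1 (qrK_unitary _ (todaX_isUnit lam t g hu))
  unfold todaH
  rw [Matrix.conjTranspose_mul, Matrix.conjTranspose_conjTranspose, Matrix.mul_assoc,
    ← Matrix.mul_assoc (qrK _), hk, Matrix.one_mul, hu]

theorem todaH_pos {n : ℕ} (lam : Fin n → ℝ) (t : ℝ) (g : Matrix (Fin n) (Fin n) ℂ)
    (hg : g ∈ UnitaryTP n) : todaH lam t g ∈ UnitaryTP n := by
  obtain ⟨hu, hL⟩ := hg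
  have hun := todaX_isUnit lam t g hu
  refine ⟨todaH_unitary lam t g hu, ?_⟩
  rw [← leftPos_iff] at hL ⊢
  apply leftPos_of_botPos _ (todaH_unitary lam t g hu)
  have hb := botPos_of_leftPos g hu hL
  have e : todaH lam t g = ((qrK (todaX lam t g))ᴴ * todaX lam t g) * (g * expD lam (-t)) := by
    have : todaX lam t g * (g * expD lam (-t)) = g := by
      unfold todaX
      calc g * expD lam t * gᴴ * (g * expD lam (-t))
          = g * expD lam t * (gᴴ * g) * expD lam (-t) := by noncomm_ring
        _ = g * (expD lam t * expD lam (-t)) := by rw [hu]; noncomm_ring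
        _ = g := by rw [expD_mul_neg, Matrix.mul_one]
    rw [Matrix.mul_assoc, this]
    rfl
  intro k hk c hc
  change 0 < ((todaH lam t g).submatrix (botE hk) c).det
  rw [e, bot_upper_mul hk _ _ (fun i j h => qrR_upper _ i j h)]
  refine mul_pos (upper_sub_det_pos _ (fun i j h => qrR_upper _ i j h)
    (qrR_diag _ hun) _ (botE_strictMono hk)) ?_
  have e2 : (g * expD lam (-t)).submatrix (botE hk) c = Matrix.of fun i j =>
      ((Real.exp (-t * lam (c j)) : ℝ) : ℂ) * (g.submatrix (botE hk) c) i j := by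
    ext i j
    simp only [expD, Matrix.submatrix_apply, Matrix.mul_diagonal, Matrix.of_apply]
    ring
  rw [e2, Matrix.det_mul_row]
  refine mul_pos (Finset.prod_pos fun i _ => ?_) (hb k hk c hc)
  exact_mod_cast Real.exp_pos _

theorem todaX_hasD {n : ℕ} (lam : Fin n → ℝ) (g : Matrix (Fin n) (Fin n) ℂ)
    (hu : gᴴ * g = 1) (t : ℝ) : HasD (fun s => todaX lam s g)
      ((g * Matrix.diagonal (fun i => (lam i : ℂ)) * gᴴ) * todaX lam t g) t := by
  have h1 : HasD (fun s => expD lam s) (Matrix.diagonal (fun i => (lam i : ℂ)) * expD lam t) t := by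
    intro i j
    by_cases hij : i = j
    · subst hij
      simp only [expD, Matrix.diagonal_mul_diagonal, Matrix.diagonal_apply_eq]
      have := (((hasDerivAt_id t).mul_const (lam i)).exp).ofReal_comp
      simpa [mul_comm] using this
    · simp only [expD, Matrix.diagonal_mul_diagonal, Matrix.diagonal_apply_ne _ hij]
      exact hasDerivAt_const _ _
  have h2 := ((HasD.const g t).mul h1).mul (HasD.const gᴴ t)
  convert h2 using 1
  unfold todaX
  simp only [Matrix.mul_zero, Matrix.zero_mul, zero_add, add_zero]
  calc g * Matrix.diagonal (fun i => (lam i : ℂ)) * gᴴ * (g * expD lam t * gᴴ)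
      = g * Matrix.diagonal (fun i => (lam i : ℂ)) * (gᴴ * g) * expD lam t * gᴴ := by noncomm_ring
    _ = _ := by rw [hu]; noncomm_ring

theorem upper_of_mul_upper {n : ℕ} (T R R' : Matrix (Fin n) (Fin n) ℂ)
    (hR : ∀ i j, j < i → R i j = 0) (hd : ∀ i, R i i ≠ 0) (hR' : ∀ i j, j < i → R' i j = 0)
    (h : R' = T * R) : (∀ i j, j < i → T i j = 0) ∧ ∀ i, R' i i = T i i * R i i := by
  have h1 : ∀ j i, j < i → T i j = 0 := by
    intro j
    induction j using WellFoundedLT.induction with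
    | _ j ih =>
    intro i hij
    have h2 : R' i j = T i j * R j j := by
      rw [h, Matrix.mul_apply]
      refine Finset.sum_eq_single j ?_ (by simp)
      intro l _ hl
      rcases lt_or_gt_of_ne hl with hl | hl
      · rw [ih l hl i (hl.trans hij), zero_mul]
      · rw [hR l j hl, mul_zero]
    rw [hR' i j hij] at h2
    exact (mul_eq_zero.1 h2.symm).resolve_right (hd j)
  refine ⟨fun i j => h1 j i, fun i => ?_⟩
  rw [h, Matrix.mul_apply]
  refine Finset.sum_eq_single i ?_ (by simp)
  intro l _ hl
  rcases lt_or_gt_of_ne hl with hl | hl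
  · rw [h1 l i hl, zero_mul]
  · rw [hR l i hl, mul_zero]

theorem toda_sol {n : ℕ} (lam : Fin n → ℝ) (g : Matrix (Fin n) (Fin n) ℂ)
    (hu : gᴴ * g = 1) (t : ℝ) :
    HasD (fun s => (qrK (todaX lam s g))ᴴ *
        (g * Matrix.diagonal (fun i => (lam i : ℂ)) * gᴴ) * qrK (todaX lam s g))
      (((qrK (todaX lam t g))ᴴ *
        (g * Matrix.diagonal (fun i => (lam i : ℂ)) * gᴴ) * qrK (todaX lam t g)) *
        iwasawaSkewPart ((qrK (todaX lam t g))ᴴ *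
        (g * Matrix.diagonal (fun i => (lam i : ℂ)) * gᴴ) * qrK (todaX lam t g)) -
        iwasawaSkewPart ((qrK (todaX lam t g))ᴴ *
        (g * Matrix.diagonal (fun i => (lam i : ℂ)) * gᴴ) * qrK (todaX lam t g)) *
        ((qrK (todaX lam t g))ᴴ *
        (g * Matrix.diagonal (fun i => (lam i : ℂ)) * gᴴ) * qrK (todaX lam t g))) t := by
  set M0 := g * Matrix.diagonal (fun i => (lam i : ℂ)) * gᴴ with hM0
  have hM0h : M0ᴴ = M0 := by
    rw [hM0, Matrix.conjTranspose_mul, Matrix.conjTranspose_mul, Matrix.diagonal_conjTranspose,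
      Matrix.conjTranspose_conjTranspose, Matrix.mul_assoc]
    congr 3
    ext i; simp
  have hXu := fun s => todaX_isUnit lam s g hu
  have hKu := fun s => qrK_unitary _ (hXu s)
  have hX' := todaX_hasD lam g hu t
  set K : ℝ → Matrix (Fin n) (Fin n) ℂ := fun s => qrK (todaX lam s g) with hK
  change HasD (fun s => (K s)ᴴ * M0 * K s) ((K t)ᴴ * M0 * K t *
    iwasawaSkewPart ((K t)ᴴ * M0 * K t) - iwasawaSkewPart ((K t)ᴴ * M0 * K t) *
    ((K t)ᴴ * M0 * K t)) t
  have hKd : ∃ K', HasD K K' t := by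
    refine ⟨Matrix.of fun i j => deriv (fun s => K s i j) t, fun i j => ?_⟩
    exact (qrK_differentiable (fun s => todaX lam s g) t (hXu t)
      (fun i j => (hX' i j).differentiableAt) i j).hasDerivAt
  obtain ⟨K', hK'⟩ := hKd
  have hKK : (K t)ᴴ * K t = 1 := hKu t
  have hKK2 : K t * (K t)ᴴ = 1 := mul_eq_one_comm.1 hKK
  have d1 := hK'.conjT.mul hK'
  have hone : (fun s => (K s)ᴴ * K s) = fun _ => 1 := funext hKu
  rw [hone] at d1
  have hz := d1.unique (HasD.const 1 t)
  set S := (K t)ᴴ * K' with hS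
  have hSh : Sᴴ = -S := by
    rw [hS, Matrix.conjTranspose_mul, Matrix.conjTranspose_conjTranspose]
    exact eq_neg_of_add_eq_zero_left hz
  have hK'S : K' = K t * S := by rw [hS, ← Matrix.mul_assoc, hKK2, Matrix.one_mul]
  have hK'Sh : K'ᴴ = -(S * (K t)ᴴ) := by
    rw [hK'S, Matrix.conjTranspose_mul, hSh, Matrix.neg_mul]
  set M := (K t)ᴴ * M0 * K t with hM
  have hMh : Mᴴ = M := by
    rw [hM, Matrix.conjTranspose_mul, Matrix.conjTranspose_mul, hM0h,
      Matrix.conjTranspose_conjTranspose]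
    exact (Matrix.mul_assoc _ _ _).symm
  set R : ℝ → Matrix (Fin n) (Fin n) ℂ := fun s => (K s)ᴴ * todaX lam s g with hR
  have dR : HasD R (K'ᴴ * todaX lam t g + (K t)ᴴ * (M0 * todaX lam t g)) t := hK'.conjT.mul hX'
  set R' := K'ᴴ * todaX lam t g + (K t)ᴴ * (M0 * todaX lam t g) with hR'
  have hXKR : todaX lam t g = K t * R t := by
    rw [hR]; simp only; rw [← Matrix.mul_assoc, hKK2, Matrix.one_mul]
  have hTR : R' = (M - S) * R t := by
    rw [hR', hK'Sh, hXKR, hM]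
    calc -(S * (K t)ᴴ) * (K t * R t) + (K t)ᴴ * (M0 * (K t * R t))
        = -(S * ((K t)ᴴ * K t) * R t) + (K t)ᴴ * M0 * K t * R t := by noncomm_ring
      _ = _ := by rw [hKK]; noncomm_ring
  have hRu : ∀ s i j, j < i → R s i j = 0 := fun s i j h => qrR_upper _ i j h
  have hRd : ∀ s i, 0 < R s i i := fun s i => qrR_diag _ (hXu s) i
  have hR'u : ∀ i j, j < i → R' i j = 0 := by
    intro i j hij
    refine (dR i j).unique ?_
    have : (fun s => R s i j) = fun _ => 0 := funext fun s => hRu s i j hij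
    rw [this]
    exact hasDerivAt_const _ _
  have hR'r : ∀ i, star (R' i i) = R' i i := by
    intro i
    refine ((dR i i).star).unique ?_
    have : (fun s => star (R s i i)) = fun s => R s i i := funext fun s =>
      (IsSelfAdjoint.of_nonneg (hRd s i).le).star_eq
    rw [this]
    exact dR i i
  obtain ⟨hTu, hTd⟩ := upper_of_mul_upper (M - S) (R t) R' (hRu t) (fun i => (hRd t i).ne') hR'u hTR
  have hSent : ∀ i j, star (S j i) = - S i j := by
    intro i j
    have := congrFun (congrFun hSh i) j
    simpa using this
  have hMent : ∀ i j, star (M j i) = M i j := by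
    intro i j
    exact congrFun (congrFun hMh i) j
  have hlow : ∀ i j, j < i → S i j = M i j := by
    intro i j hij
    have := hTu i j hij
    rw [Matrix.sub_apply, sub_eq_zero] at this
    exact this.symm
  have hSM : S = iwasawaSkewPart M := by
    ext i j
    simp only [iwasawaSkewPart, Matrix.of_apply]
    split_ifs with h1 h2
    · exact hlow i j h1
    · have := hSent i j
      rw [hlow j i h2, hMent] at this
      rw [this, neg_neg]
    · have hij : i = j := le_antisymm (not_lt.1 h1) (not_lt.1 h2)
      subst hij
      have h3 := hTd i
      have h4 := congrArg star h3
      rw [hR'r, star_mul', (IsSelfAdjoint.of_nonneg (hRd t i).le).star_eq, h3, Matrix.sub_apply,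
        star_sub, hMent, hSent] at h4
      have h5 := mul_right_cancel₀ (hRd t i).ne' h4
      have h6 : (2 : ℂ) * S i i = 0 := by linear_combination -h5
      simpa using h6
  rw [← hSM]
  have d2 := (hK'.conjT.mul (HasD.const M0 t)).mul hK'
  convert d2 using 1
  rw [Matrix.mul_zero, add_zero, hK'Sh, hK'S, hM]
  noncomm_ring


end Toda

section Final

theorem todaH_conj {n : ℕ} (lam : Fin n → ℝ) (g : Matrix (Fin n) (Fin n) ℂ) (t : ℝ) :
    todaH lam t g * (Complex.I • Matrix.diagonal (fun i => (lam i : ℂ))) * (todaH lam t g)ᴴ =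
      Complex.I • ((qrK (todaX lam t g))ᴴ *
        (g * Matrix.diagonal (fun i => (lam i : ℂ)) * gᴴ) * qrK (todaX lam t g)) := by
  unfold todaH
  rw [Matrix.conjTranspose_mul, Matrix.conjTranspose_conjTranspose, Matrix.mul_smul,
    Matrix.smul_mul]
  congr 1
  simp only [Matrix.mul_assoc]

theorem toda_flow {n : ℕ} (lam : Fin n → ℝ) (g : Matrix (Fin n) (Fin n) ℂ)
    (hu : gᴴ * g = 1) (L : ℝ → Matrix (Fin n) (Fin n) ℂ)
    (hL : L = fun t => todaH lam t g * (Complex.I • Matrix.diagonal (fun i => (lam i : ℂ))) *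
      (todaH lam t g)ᴴ) (t : ℝ) :
    HasD L (L t * iwasawaSkewPart ((-Complex.I) • L t) -
        iwasawaSkewPart ((-Complex.I) • L t) * L t) t := by
  have h := toda_sol lam g hu t
  have e : L = fun t => Complex.I • ((qrK (todaX lam t g))ᴴ *
        (g * Matrix.diagonal (fun i => (lam i : ℂ)) * gᴴ) * qrK (todaX lam t g)) := by
    rw [hL]; funext s; exact todaH_conj lam g s
  rw [e]
  simp only [smul_smul, neg_mul, Complex.I_mul_I, neg_neg, one_smul]
  intro i j
  have h2 := (h i j).const_mul Complex.I
  rw [Matrix.smul_mul, Matrix.mul_smul, ← smul_sub]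
  exact h2

theorem todaH_zero {n : ℕ} (lam : Fin n → ℝ) (g : Matrix (Fin n) (Fin n) ℂ)
    (hu : gᴴ * g = 1) : todaH lam 0 g = g := by
  have h : todaX lam 0 g = 1 := by
    have : expD lam 0 = 1 := by
      unfold expD; simp
    rw [todaX, this, Matrix.mul_one, mul_eq_one_comm.1 hu]
  rw [todaH, h, qrK_one, Matrix.conjTranspose_one, Matrix.one_mul]

/-- the Toda vector field on `Fin n → Fin n → ℂ` -/
noncomputable def todaV {n : ℕ} (A : Fin n → Fin n → ℂ) : Fin n → Fin n → ℂ :=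
  fun i j => (Matrix.of A * iwasawaSkewPart ((-Complex.I) • Matrix.of A) -
        iwasawaSkewPart ((-Complex.I) • Matrix.of A) * Matrix.of A) i j

theorem todaV_contDiff {n : ℕ} : ContDiff ℝ 1 (todaV (n := n)) := by
  have h1 : ∀ i j : Fin n, ContDiff ℝ 1 (fun A : Fin n → Fin n → ℂ => A i j) := fun i j =>
    contDiff_apply_apply ℝ ℂ i j
  have h2 : ∀ i j : Fin n, ContDiff ℝ 1 (fun A : Fin n → Fin n → ℂ =>
      iwasawaSkewPart ((-Complex.I) • Matrix.of A) i j) := by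
    intro i j
    simp only [iwasawaSkewPart, Matrix.of_apply, Matrix.smul_apply, smul_eq_mul]
    split_ifs
    · exact contDiff_const.mul (h1 i j)
    · exact (contDiff_const.mul (h1 i j)).neg
    · exact contDiff_const
  refine contDiff_pi.2 fun i => contDiff_pi.2 fun j => ?_
  simp only [todaV, Matrix.sub_apply, Matrix.mul_apply]
  refine ContDiff.sub (ContDiff.sum fun l _ => ?_) (ContDiff.sum fun l _ => ?_)
  · exact (h1 i l).mul (h2 l j)
  · exact (h2 i l).mul (h1 l j)

theorem toda_unique {n : ℕ} (L L' : ℝ → Matrix (Fin n) (Fin n) ℂ)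
    (hL : ∀ t, HasD L (L t * iwasawaSkewPart ((-Complex.I) • L t) -
        iwasawaSkewPart ((-Complex.I) • L t) * L t) t)
    (hL' : ∀ t, HasD L' (L' t * iwasawaSkewPart ((-Complex.I) • L' t) -
        iwasawaSkewPart ((-Complex.I) • L' t) * L' t) t)
    (h0 : L 0 = L' 0) : ∀ t, L t = L' t := by
  let f : ℝ → Fin n → Fin n → ℂ := fun t i j => L t i j
  let f' : ℝ → Fin n → Fin n → ℂ := fun t i j => L' t i j
  have hf : ∀ t, HasDerivAt f (todaV (f t)) t := fun t =>
    hasDerivAt_pi.2 fun i => hasDerivAt_pi.2 fun j => hL t i j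
  have hf' : ∀ t, HasDerivAt f' (todaV (f' t)) t := fun t =>
    hasDerivAt_pi.2 fun i => hasDerivAt_pi.2 fun j => hL' t i j
  have hc : Continuous f := continuous_iff_continuousAt.2 fun t => (hf t).continuousAt
  have hc' : Continuous f' := continuous_iff_continuousAt.2 fun t => (hf' t).continuousAt
  have hcl : IsClopen {t | f t = f' t} := by
    refine ⟨isClosed_eq hc hc', ?_⟩
    rw [isOpen_iff_mem_nhds]
    intro t ht
    obtain ⟨C, s, hs, hlip⟩ :=
      (todaV_contDiff (n := n)).contDiffAt (x := f t) |>.exists_lipschitzOnWith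
    have h1 : ∀ᶠ r in nhds t, f r ∈ s := hc.continuousAt hs
    have h2 : ∀ᶠ r in nhds t, f' r ∈ s := by
      refine hc'.continuousAt ?_
      rw [← show f t = f' t from ht]; exact hs
    exact ODE_solution_unique_of_eventually (v := fun _ => todaV) (s := fun _ => s) (K := C)
      (Filter.Eventually.of_forall fun _ => hlip)
      (h1.mono fun r hr => ⟨hf r, hr⟩) (h2.mono fun r hr => ⟨hf' r, hr⟩) ht
  have hu := hcl.eq_univ ⟨0, show f 0 = f' 0 from h0⟩
  intro t
  have : t ∈ {t | f t = f' t} := by rw [hu]; trivial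
  exact this

theorem closure_UTP_unitary {n : ℕ} : closure (UnitaryTP n) ⊆ {g | gᴴ * g = 1} := by
  refine closure_minimal (fun g hg => hg.1) ?_
  refine isClosed_eq ?_ continuous_const
  exact (continuous_id.matrix_conjTranspose).matrix_mul continuous_id

theorem closure_UTP_compact {n : ℕ} : IsCompact (closure (UnitaryTP n)) := by
  have hc : IsCompact (Set.pi Set.univ fun _ : Fin n => Set.pi Set.univ fun _ : Fin n =>
      Metric.closedBall (0 : ℂ) 1) :=
    isCompact_univ_pi fun _ => isCompact_univ_pi fun _ => isCompact_closedBall _ _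
  refine IsCompact.of_isClosed_subset hc isClosed_closure ?_
  intro g hg i _ j _
  have hu := closure_UTP_unitary hg
  rw [mem_closedBall_zero_iff]
  exact entry_norm_bound_of_unitary (Matrix.mem_unitaryGroup_iff'.2 hu) i j

theorem todaH_continuousAt {n : ℕ} (lam : Fin n → ℝ) (t : ℝ) (g : Matrix (Fin n) (Fin n) ℂ)
    (hu : gᴴ * g = 1) : ContinuousAt (todaH lam t) g := by
  have hX : Continuous (todaX lam t) :=
    (continuous_id.matrix_mul continuous_const).matrix_mul continuous_id.matrix_conjTranspose
  have hK : ContinuousAt (fun x => qrK (todaX lam t x)) g :=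
    continuousAt_pi.2 fun i => continuousAt_pi.2 fun j =>
      qrK_continuousAt (todaX lam t) g (todaX_isUnit lam t g hu)
        (fun i j => (hX.matrix_elem i j).continuousAt) i j
  have hKs : ContinuousAt (fun x => (qrK (todaX lam t x))ᴴ) g :=
    (continuous_id.matrix_conjTranspose).continuousAt.comp hK
  exact hKs.mul continuousAt_id

end Final

/-- Let `λ` be strictly decreasing. Every solution
`L : ℝ → Matrix (Fin n) (Fin n) ℂ` of the full symmetric Toda equation
`L′(t) = [L(t), χ(−i·L(t))]` (derivatives taken entrywise) with `L(0) ∈ O_λ^{≥0}`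
satisfies `L(t) ∈ O_λ^{≥0}` for all `t ∈ ℝ`: the full symmetric Toda flow weakly
preserves positivity in both time directions. -/
theorem toda_flow_preserves_positivity {n : ℕ}
    (lam : Fin n → ℝ) (hanti : StrictAnti lam)
    (L : ℝ → Matrix (Fin n) (Fin n) ℂ)
    (hflow : ∀ t : ℝ, ∀ i j : Fin n, HasDerivAt (fun s => L s i j)
      ((L t * iwasawaSkewPart ((-Complex.I) • L t) -
        iwasawaSkewPart ((-Complex.I) • L t) * L t) i j) t)
    (h0 : L 0 ∈ SkewOrbitTNN lam) :
    ∀ t : ℝ, L t ∈ SkewOrbitTNN lam := by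

  set F : Matrix (Fin n) (Fin n) ℂ → Matrix (Fin n) (Fin n) ℂ := fun g =>
    g * (Complex.I • Matrix.diagonal (fun i => (lam i : ℂ))) * gᴴ with hF
  have hFc : Continuous F :=
    (continuous_id.matrix_mul continuous_const).matrix_mul continuous_id.matrix_conjTranspose
  have hTP : SkewOrbitTP lam = F '' UnitaryTP n := by
    ext A
    constructor
    · rintro ⟨g, hg, rfl⟩
      exact ⟨g, hg, rfl⟩
    · rintro ⟨g, hg, rfl⟩
      exact ⟨g, hg, rfl⟩
  have hTNN : SkewOrbitTNN lam = F '' closure (UnitaryTP n) := by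
    rw [SkewOrbitTNN, hTP]
    exact (image_closure_of_isCompact closure_UTP_compact hFc.continuousOn).symm
  rw [hTNN] at h0 ⊢
  obtain ⟨g, hg, hg0⟩ := h0
  have hu : gᴴ * g = 1 := closure_UTP_unitary hg
  intro t
  refine ⟨todaH lam t g, ?_, ?_⟩
  · exact (todaH_continuousAt lam t g hu).continuousWithinAt.mem_closure hg
      fun x hx => todaH_pos lam t x hx
  · refine (toda_unique L (fun t => F (todaH lam t g)) hflow
      (fun t => toda_flow lam g hu _ rfl t) ?_ t).symm
    simp only [todaH_zero lam g hu]
    exact hg0.symm
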